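/- Along any B₀ T²-symmetric Einstein flow, at every time τ one has |⟨e^{ρ−2τ} V_τ⟩| − e^{−2τ}|A| ≲ e^{−τ} e^{2(ΠE)^{1/2}} Π E. -/

import Mathlib

noncomputable section

open Real MeasureTheory intervalIntegral

/-- The θ-mean of a function on the circle of circumference 1 (total measure 1). -/
def circleMean (f : ℝ → ℝ) : ℝ := ∫ θ in (0:ℝ)..1, f θ

/-- The smooth, θ-periodic fields `V, Q, ρ, l` of a T²-symmetric spacetime in areal
coordinates; first argument is `τ`, second is `θ`. -/
structure T2Flow where
  V : ℝ → ℝ → ℝ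
  Q : ℝ → ℝ → ℝ
  ρ : ℝ → ℝ → ℝ
  l : ℝ → ℝ → ℝ
  smooth_V : ContDiff ℝ (⊤ : ℕ∞) (Function.uncurry V)
  smooth_Q : ContDiff ℝ (⊤ : ℕ∞) (Function.uncurry Q)
  smooth_ρ : ContDiff ℝ (⊤ : ℕ∞) (Function.uncurry ρ)
  smooth_l : ContDiff ℝ (⊤ : ℕ∞) (Function.uncurry l)
  periodic_V : ∀ τ, Function.Periodic (V τ) 1
  periodic_Q : ∀ τ, Function.Periodic (Q τ) 1
  periodic_ρ : ∀ τ, Function.Periodic (ρ τ) 1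
  periodic_l : ∀ τ, Function.Periodic (l τ) 1

namespace T2Flow

/-- `V_τ`. -/
def Vτ (F : T2Flow) (τ θ : ℝ) : ℝ := deriv (fun s => F.V s θ) τ
/-- `V_θ`. -/
def Vθ (F : T2Flow) (τ θ : ℝ) : ℝ := deriv (fun x => F.V τ x) θ
/-- `Q_τ`. -/
def Qτ (F : T2Flow) (τ θ : ℝ) : ℝ := deriv (fun s => F.Q s θ) τ
/-- `Q_θ`. -/
def Qθ (F : T2Flow) (τ θ : ℝ) : ℝ := deriv (fun x => F.Q τ x) θ
/-- `ρ_τ`. -/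
def ρτ (F : T2Flow) (τ θ : ℝ) : ℝ := deriv (fun s => F.ρ s θ) τ
/-- `l_τ`. -/
def lτ (F : T2Flow) (τ θ : ℝ) : ℝ := deriv (fun s => F.l s θ) τ
/-- `l_θ`. -/
def lθ (F : T2Flow) (τ θ : ℝ) : ℝ := deriv (fun x => F.l τ x) θ

/-- The energy density
`J = (1/2)[V_τ² + e^{2(τ−ρ)}V_θ² + e^{2(V−τ)}(Q_τ² + e^{2(τ−ρ)}Q_θ²)]`. -/
def J (F : T2Flow) (τ θ : ℝ) : ℝ :=
  (1/2) * (F.Vτ τ θ ^ 2 + exp (2*(τ - F.ρ τ θ)) * F.Vθ τ θ ^ 2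
    + exp (2*(F.V τ θ - τ)) * (F.Qτ τ θ ^ 2 + exp (2*(τ - F.ρ τ θ)) * F.Qθ τ θ ^ 2))

/-- The T²-symmetric vacuum Einstein evolution equations together with the
momentum constraint. -/
def IsEinsteinFlow (F : T2Flow) : Prop :=
  (∀ τ θ : ℝ, deriv (fun s => exp (F.ρ s θ) * F.Vτ s θ) τ
      = deriv (fun x => exp (2*τ - F.ρ τ x) * F.Vθ τ x) θ
        + exp (2*(F.V τ θ - τ) + F.ρ τ θ)
          * (F.Qτ τ θ ^ 2 - exp (2*(τ - F.ρ τ θ)) * F.Qθ τ θ ^ 2)) ∧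
  (∀ τ θ : ℝ, deriv (fun s => exp (F.ρ s θ + 2*(F.V s θ - s)) * F.Qτ s θ) τ
      = deriv (fun x => exp (-F.ρ τ x + 2*F.V τ x) * F.Qθ τ x) θ) ∧
  (∀ τ θ : ℝ, F.lτ τ θ + F.ρτ τ θ + 2 = F.J τ θ) ∧
  (∀ τ θ : ℝ, F.ρτ τ θ = exp (F.l τ θ)) ∧
  (∀ τ θ : ℝ, F.lθ τ θ = F.Vθ τ θ * F.Vτ τ θ
      + exp (2*(F.V τ θ - τ)) * F.Qθ τ θ * F.Qτ τ θ)

/-- The conserved quantity `A = ∫ e^ρ (V_τ − e^{2(V−τ)} Q_τ Q) dθ`. -/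
def A (F : T2Flow) (τ : ℝ) : ℝ :=
  ∫ θ in (0:ℝ)..1,
    exp (F.ρ τ θ) * (F.Vτ τ θ - exp (2*(F.V τ θ - τ)) * F.Qτ τ θ * F.Q τ θ)

/-- The conserved quantity `B = ∫ e^{ρ+2(V−τ)} Q_τ dθ`. -/
def B (F : T2Flow) (τ : ℝ) : ℝ :=
  ∫ θ in (0:ℝ)..1, exp (F.ρ τ θ + 2*(F.V τ θ - τ)) * F.Qτ τ θ

/-- The energy `E = ∫ e^{ρ−2τ} J dθ`. -/
def E (F : T2Flow) (τ : ℝ) : ℝ := ∫ θ in (0:ℝ)..1, exp (F.ρ τ θ - 2*τ) * F.J τ θ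

/-- The `S¹`-volume `Π = ⟨e^ρ⟩`. -/
def Pi (F : T2Flow) (τ : ℝ) : ℝ := ∫ θ in (0:ℝ)..1, exp (F.ρ τ θ)

/-- The correction `Λ = (1/2) e^{−2τ} ∫ V_τ (V − ⟨V⟩ − 1) e^ρ dθ`. -/
def Λ (F : T2Flow) (τ : ℝ) : ℝ :=
  (1/2) * exp (-2*τ) *
    ∫ θ in (0:ℝ)..1, F.Vτ τ θ * (F.V τ θ - circleMean (F.V τ) - 1) * exp (F.ρ τ θ)

/-- The corrected, normalized energy `H = Π (E + Λ)`. -/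
def H (F : T2Flow) (τ : ℝ) : ℝ := F.Pi τ * (F.E τ + F.Λ τ)

/-- The twist potential `Y = ⟨e^{l+ρ+2τ}⟩`. -/
def Y (F : T2Flow) (τ : ℝ) : ℝ := ∫ θ in (0:ℝ)..1, exp (F.l τ θ + F.ρ τ θ + 2*τ)

/-- The error term `Ω = ⟨e^{l+ρ+2τ} J⟩ − e^{2τ} E Y Π⁻¹`. -/
def Ω (F : T2Flow) (τ : ℝ) : ℝ :=
  (∫ θ in (0:ℝ)..1, exp (F.l τ θ + F.ρ τ θ + 2*τ) * F.J τ θ)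
    - exp (2*τ) * F.E τ * F.Y τ / F.Pi τ

end T2Flow

/-- Cauchy–Schwarz on `[0, 1]` in the form used for weighted `L¹` bounds. -/
lemma integral_abs_le_sqrt_mul_sqrt {h p q : ℝ → ℝ} (hh : Continuous h) (hp : Continuous p)
    (hq : Continuous q) (hp0 : ∀ x, 0 ≤ p x) (hq0 : ∀ x, 0 ≤ q x)
    (hpq : ∀ x, h x ^ 2 ≤ p x * q x) :
    ∫ x in (0:ℝ)..1, |h x| ≤ √((∫ x in (0:ℝ)..1, p x) * ∫ x in (0:ℝ)..1, q x) := by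
  apply Real.le_sqrt_of_sq_le
  have key : ∀ t : ℝ, 0 ≤ (∫ x in (0:ℝ)..1, p x) * (t * t)
      + (-2 * ∫ x in (0:ℝ)..1, |h x|) * t + ∫ x in (0:ℝ)..1, q x := by
    intro t
    have hint : ∫ x in (0:ℝ)..1, (p x * (t * t) + (-2 * |h x|) * t + q x)
        = (∫ x in (0:ℝ)..1, p x) * (t * t)
          + (-2 * ∫ x in (0:ℝ)..1, |h x|) * t + ∫ x in (0:ℝ)..1, q x := by
      rw [intervalIntegral.integral_add, intervalIntegral.integral_add,
        intervalIntegral.integral_mul_const, intervalIntegral.integral_mul_const,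
        intervalIntegral.integral_const_mul]
      all_goals exact Continuous.intervalIntegrable (by fun_prop) _ _
    rw [← hint]
    refine intervalIntegral.integral_nonneg zero_le_one fun x _ => ?_
    have h1 : |h x| ≤ √(p x) * √(q x) := by
      rw [← Real.sqrt_mul (hp0 x)]
      exact Real.abs_le_sqrt (hpq x)
    have h2 : |h x| * t ≤ |t| * (√(p x) * √(q x)) := by
      calc |h x| * t ≤ |h x| * |t| := mul_le_mul_of_nonneg_left (le_abs_self t) (abs_nonneg _)
        _ ≤ _ := by rw [mul_comm]; exact mul_le_mul_of_nonneg_left h1 (abs_nonneg t)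
    have h3 := Real.sq_sqrt (hp0 x)
    have h4 := Real.sq_sqrt (hq0 x)
    have h5 : p x * (t * t) = √(p x) ^ 2 * |t| ^ 2 := by rw [h3, sq_abs]; ring
    nlinarith [sq_nonneg (√(p x) * |t| - √(q x))]
  have hd := discrim_le_zero key
  rw [discrim] at hd
  nlinarith

/-- On `[0, 1]` the oscillation of a `C¹` function is at most the `L¹` norm of its derivative. -/
lemma abs_sub_le_integral_abs_deriv {f f' : ℝ → ℝ} (hf : ∀ x, HasDerivAt f (f' x) x)
    (hf' : Continuous f') {a b : ℝ} (ha : a ∈ Set.Icc (0:ℝ) 1) (hb : b ∈ Set.Icc (0:ℝ) 1) :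
    |f a - f b| ≤ ∫ x in (0:ℝ)..1, |f' x| := by
  wlog hab : b ≤ a generalizing a b
  · rw [abs_sub_comm]
    exact this hb ha (le_of_not_ge hab)
  rw [← intervalIntegral.integral_eq_sub_of_hasDerivAt (fun x _ => hf x)
    (hf'.intervalIntegrable _ _)]
  refine (intervalIntegral.abs_integral_le_integral_abs hab).trans ?_
  exact intervalIntegral.integral_mono_interval hb.1 hab ha.2
    (Filter.Eventually.of_forall fun x => abs_nonneg _) (hf'.abs.intervalIntegrable _ _)

section Slices

variable {f : ℝ → ℝ → ℝ}

lemma hasDerivAt_slice_snd (hf : ContDiff ℝ (⊤ : ℕ∞) (Function.uncurry f)) (τ θ : ℝ) :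
    HasDerivAt (fun x => f τ x) (deriv (fun x => f τ x) θ) θ := by
  have h : ContDiff ℝ (⊤ : ℕ∞) (fun x => Function.uncurry f (τ, x)) := by fun_prop
  exact (h.differentiable (by simp) θ).hasDerivAt

lemma continuous_slice (hf : ContDiff ℝ (⊤ : ℕ∞) (Function.uncurry f)) (τ : ℝ) :
    Continuous (fun θ => f τ θ) :=
  hf.continuous.comp (Continuous.prodMk_right τ)

lemma continuous_deriv_slice_snd (hf : ContDiff ℝ (⊤ : ℕ∞) (Function.uncurry f)) (τ : ℝ) :
    Continuous (fun θ => deriv (fun x => f τ x) θ) := by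
  have h : ContDiff ℝ (⊤ : ℕ∞) (fun x => Function.uncurry f (τ, x)) := by fun_prop
  exact h.continuous_deriv (by simp)

lemma continuous_deriv_slice_fst (hf : ContDiff ℝ (⊤ : ℕ∞) (Function.uncurry f)) (τ : ℝ) :
    Continuous (fun θ => deriv (fun s => f s θ) τ) := by
  have h : (fun θ => deriv (fun s => f s θ) τ)
      = fun θ => fderiv ℝ (Function.uncurry f) (τ, θ) (1, 0) := by
    funext θ
    have hd := (hf.differentiable (by simp) (τ, θ)).hasFDerivAt
    exact (hd.comp_hasDerivAt τ ((hasDerivAt_id τ).prodMk (hasDerivAt_const τ θ))).deriv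
  rw [h]
  exact ((hf.continuous_fderiv (by simp)).comp (Continuous.prodMk_right τ)).clm_apply
    continuous_const

end Slices

namespace T2Flow

variable (F : T2Flow) (τ : ℝ)

lemma continuous_V : Continuous (F.V τ) := continuous_slice F.smooth_V τ
lemma continuous_Q : Continuous (F.Q τ) := continuous_slice F.smooth_Q τ
lemma continuous_ρ : Continuous (F.ρ τ) := continuous_slice F.smooth_ρ τ
lemma continuous_Vτ : Continuous (F.Vτ τ) := continuous_deriv_slice_fst F.smooth_V τ
lemma continuous_Qτ : Continuous (F.Qτ τ) := continuous_deriv_slice_fst F.smooth_Q τ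
lemma continuous_Vθ : Continuous (F.Vθ τ) := continuous_deriv_slice_snd F.smooth_V τ
lemma continuous_Qθ : Continuous (F.Qθ τ) := continuous_deriv_slice_snd F.smooth_Q τ

lemma continuous_J : Continuous (F.J τ) := by
  have := F.continuous_V τ
  have := F.continuous_ρ τ
  have := F.continuous_Vτ τ
  have := F.continuous_Qτ τ
  have := F.continuous_Vθ τ
  have := F.continuous_Qθ τ
  unfold J
  fun_prop

lemma J_nonneg (θ : ℝ) : 0 ≤ F.J τ θ := by
  unfold J
  positivity

/-- A quantity dominated pointwise by `k² e^ρ · 2 e^{ρ-2τ} J` has `L¹` norm `≤ k (2ΠE)^{1/2}`. -/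
lemma integral_abs_le_energy {h : ℝ → ℝ} (hh : Continuous h) {k : ℝ} (hk : 0 ≤ k)
    (hle : ∀ θ, h θ ^ 2 ≤ k ^ 2 * (exp (F.ρ τ θ) ^ 2 * exp (-2 * τ) * (2 * F.J τ θ))) :
    ∫ θ in (0:ℝ)..1, |h θ| ≤ k * √(2 * (F.Pi τ * F.E τ)) := by
  have hρ := F.continuous_ρ τ
  have hJ := F.continuous_J τ
  have hJ0 := F.J_nonneg τ
  have key := integral_abs_le_sqrt_mul_sqrt (h := h) (p := fun θ => exp (F.ρ τ θ))
    (q := fun θ => (2 * k ^ 2) * (exp (F.ρ τ θ - 2 * τ) * F.J τ θ)) hh (by fun_prop)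
    (by fun_prop) (fun _ => (exp_pos _).le)
    (fun θ => mul_nonneg (by positivity) (mul_nonneg (exp_pos _).le (hJ0 θ))) (fun θ => by
      refine (hle θ).trans_eq ?_
      rw [sub_eq_add_neg, exp_add, neg_mul]
      ring)
  rw [intervalIntegral.integral_const_mul] at key
  refine key.trans_eq ?_
  change √(F.Pi τ * (2 * k ^ 2 * F.E τ)) = _
  rw [show F.Pi τ * (2 * k ^ 2 * F.E τ) = k ^ 2 * (2 * (F.Pi τ * F.E τ)) by ring,
    Real.sqrt_mul (sq_nonneg k), Real.sqrt_sq hk]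

lemma two_mul_J (θ : ℝ) :
    exp (F.ρ τ θ) ^ 2 * exp (-2 * τ) * (2 * F.J τ θ)
      = exp (F.ρ τ θ) ^ 2 * exp (-2 * τ) * F.Vτ τ θ ^ 2 + F.Vθ τ θ ^ 2
        + exp (-2 * τ) * ((exp (F.ρ τ θ + F.V τ θ - τ) * F.Qτ τ θ) ^ 2
          + (exp (F.V τ θ) * F.Qθ τ θ) ^ 2) := by
  have h1 : exp (F.ρ τ θ) ^ 2 * exp (-2 * τ) * exp (2 * (τ - F.ρ τ θ)) = 1 := by
    rw [← exp_nat_mul, ← exp_add, ← exp_add, ← exp_zero]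
    congr 1
    push_cast
    ring
  have h2 : exp (F.ρ τ θ + F.V τ θ - τ) ^ 2
      = exp (F.ρ τ θ) ^ 2 * exp (2 * (F.V τ θ - τ)) := by
    rw [← exp_nat_mul, ← exp_nat_mul, ← exp_add]
    congr 1
    push_cast
    ring
  have h3 : exp (-2 * τ) * exp (F.V τ θ) ^ 2 = exp (2 * (F.V τ θ - τ)) := by
    rw [← exp_nat_mul, ← exp_add]
    congr 1
    push_cast
    ring
  rw [J, mul_pow, mul_pow, h2]
  linear_combination (F.Vθ τ θ ^ 2 + exp (2 * (F.V τ θ - τ)) * F.Qθ τ θ ^ 2) * h1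
    - F.Qθ τ θ ^ 2 * h3

lemma exp_sq_mul_exp_neg : exp τ ^ 2 * exp (-2 * τ) = 1 := by
  rw [← exp_nat_mul, ← exp_add, ← exp_zero]
  congr 1
  push_cast
  ring

lemma integral_abs_Vθ_le : ∫ θ in (0:ℝ)..1, |F.Vθ τ θ| ≤ √(2 * (F.Pi τ * F.E τ)) := by
  rw [← one_mul √_]
  refine F.integral_abs_le_energy τ (F.continuous_Vθ τ) zero_le_one fun θ => ?_
  rw [two_mul_J, one_pow, one_mul, add_right_comm]
  exact le_add_of_nonneg_left (by positivity)

lemma integral_abs_Qτ_le : ∫ θ in (0:ℝ)..1, |exp (F.ρ τ θ + F.V τ θ - τ) * F.Qτ τ θ|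
    ≤ exp τ * √(2 * (F.Pi τ * F.E τ)) := by
  have := F.continuous_V τ
  have := F.continuous_ρ τ
  have := F.continuous_Qτ τ
  refine F.integral_abs_le_energy τ (by fun_prop) (exp_pos τ).le fun θ => ?_
  rw [two_mul_J, mul_add, ← mul_assoc (exp τ ^ 2) (exp (-2 * τ)) (_ + _), exp_sq_mul_exp_neg,
    one_mul, add_left_comm]
  exact le_add_of_nonneg_right (by positivity)

lemma integral_abs_Qθ_le : ∫ θ in (0:ℝ)..1, |exp (F.V τ θ) * F.Qθ τ θ|
    ≤ exp τ * √(2 * (F.Pi τ * F.E τ)) := by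
  have := F.continuous_V τ
  have := F.continuous_Qθ τ
  refine F.integral_abs_le_energy τ (by fun_prop) (exp_pos τ).le fun θ => ?_
  rw [two_mul_J, mul_add, ← mul_assoc (exp τ ^ 2) (exp (-2 * τ)) (_ + _), exp_sq_mul_exp_neg,
    one_mul, ← add_assoc]
  exact le_add_of_nonneg_left (by positivity)

lemma exp_V_mul_abs_Q_sub_le {θ : ℝ} (hθ : θ ∈ Set.Icc (0:ℝ) 1) :
    exp (F.V τ θ) * |F.Q τ θ - F.Q τ 0|
      ≤ exp √(2 * (F.Pi τ * F.E τ)) * (exp τ * √(2 * (F.Pi τ * F.E τ))) := by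
  have hV := F.continuous_V τ
  have hQθ := F.continuous_Qθ τ
  calc exp (F.V τ θ) * |F.Q τ θ - F.Q τ 0|
      ≤ exp (F.V τ θ) * ∫ x in (0:ℝ)..1, |F.Qθ τ x| := by
        gcongr
        exact abs_sub_le_integral_abs_deriv (hasDerivAt_slice_snd F.smooth_Q τ) hQθ hθ (by simp)
    _ = ∫ x in (0:ℝ)..1, exp (F.V τ θ) * |F.Qθ τ x| :=
        (intervalIntegral.integral_const_mul _ _).symm
    _ ≤ ∫ x in (0:ℝ)..1, exp √(2 * (F.Pi τ * F.E τ)) * |exp (F.V τ x) * F.Qθ τ x| := by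
        refine intervalIntegral.integral_mono_on zero_le_one
          (Continuous.intervalIntegrable (by fun_prop) _ _)
          (Continuous.intervalIntegrable (by fun_prop) _ _) fun x hx => ?_
        rw [abs_mul, abs_of_pos (exp_pos _), ← mul_assoc, ← exp_add]
        gcongr
        have hosc := (abs_sub_le_integral_abs_deriv (hasDerivAt_slice_snd F.smooth_V τ)
          (F.continuous_Vθ τ) hθ hx).trans (F.integral_abs_Vθ_le τ)
        linarith [le_abs_self (F.V τ θ - F.V τ x)]
    _ ≤ _ := by
        rw [intervalIntegral.integral_const_mul]
        gcongr
        exact F.integral_abs_Qθ_le τ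

/-- If `B = 0`, then `Q` may be replaced by `Q - Q(0)` in the twist term of `A`. -/
lemma integral_Vτ_sub_A_eq (hB : F.B τ = 0) :
    (∫ θ in (0:ℝ)..1, exp (F.ρ τ θ - 2 * τ) * F.Vτ τ θ) - exp (-2 * τ) * F.A τ
      = ∫ θ in (0:ℝ)..1, exp (-3 * τ) * ((exp (F.ρ τ θ + F.V τ θ - τ) * F.Qτ τ θ)
          * (exp (F.V τ θ) * (F.Q τ θ - F.Q τ 0))) := by
  have hV := F.continuous_V τ
  have hQ := F.continuous_Q τ
  have hρ := F.continuous_ρ τ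
  have hVτ := F.continuous_Vτ τ
  have hQτ := F.continuous_Qτ τ
  have hsub : ∫ θ in (0:ℝ)..1, exp (-3 * τ) * ((exp (F.ρ τ θ + F.V τ θ - τ) * F.Qτ τ θ)
          * (exp (F.V τ θ) * (F.Q τ θ - F.Q τ 0)))
      = (∫ θ in (0:ℝ)..1, exp (F.ρ τ θ - 2 * τ) * F.Vτ τ θ) - exp (-2 * τ) * F.A τ
        - exp (-2 * τ) * F.Q τ 0 * F.B τ := by
    rw [A, B, ← intervalIntegral.integral_const_mul, ← intervalIntegral.integral_const_mul,
      ← intervalIntegral.integral_sub, ← intervalIntegral.integral_sub]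
    · refine intervalIntegral.integral_congr fun θ _ => ?_
      have h1 : exp (-3 * τ) * exp (F.ρ τ θ + F.V τ θ - τ) * exp (F.V τ θ)
          = exp (-2 * τ) * exp (F.ρ τ θ + 2 * (F.V τ θ - τ)) := by
        simp only [← exp_add]
        congr 1
        ring
      have h2 : exp (F.ρ τ θ - 2 * τ) = exp (-2 * τ) * exp (F.ρ τ θ) := by
        rw [← exp_add]
        congr 1
        ring
      have h3 := exp_add (F.ρ τ θ) (2 * (F.V τ θ - τ))
      rw [h2]
      linear_combination F.Qτ τ θ * (F.Q τ θ - F.Q τ 0) * h1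
        + exp (-2 * τ) * F.Qτ τ θ * F.Q τ θ * h3
    all_goals exact Continuous.intervalIntegrable (by fun_prop) _ _
  rw [hsub, hB, mul_zero, sub_zero]

lemma abs_integral_Vτ_sub_A_le (hB : F.B τ = 0) :
    |(∫ θ in (0:ℝ)..1, exp (F.ρ τ θ - 2 * τ) * F.Vτ τ θ) - exp (-2 * τ) * F.A τ|
      ≤ exp (-3 * τ) * ((exp τ * √(2 * (F.Pi τ * F.E τ)))
        * (exp √(2 * (F.Pi τ * F.E τ)) * (exp τ * √(2 * (F.Pi τ * F.E τ))))) := by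
  have hV := F.continuous_V τ
  have hQ := F.continuous_Q τ
  have hρ := F.continuous_ρ τ
  have hQτ := F.continuous_Qτ τ
  rw [F.integral_Vτ_sub_A_eq τ hB, intervalIntegral.integral_const_mul, abs_mul,
    abs_of_pos (exp_pos _)]
  refine mul_le_mul_of_nonneg_left ?_ (exp_pos _).le
  refine (intervalIntegral.abs_integral_le_integral_abs zero_le_one).trans ?_
  refine le_trans ?_ (mul_le_mul_of_nonneg_right (F.integral_abs_Qτ_le τ) (by positivity))
  rw [← intervalIntegral.integral_mul_const]
  refine intervalIntegral.integral_mono_on zero_le_one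
    (Continuous.intervalIntegrable (by fun_prop) _ _)
    (Continuous.intervalIntegrable (by fun_prop) _ _) fun θ hθ => ?_
  rw [abs_mul]
  refine mul_le_mul_of_nonneg_left ?_ (abs_nonneg _)
  rw [abs_mul, abs_of_pos (exp_pos _)]
  exact F.exp_V_mul_abs_Q_sub_le τ hθ

lemma Pi_mul_E_nonneg : 0 ≤ F.Pi τ * F.E τ :=
  mul_nonneg (intervalIntegral.integral_nonneg zero_le_one fun _ _ => (exp_pos _).le)
    (intervalIntegral.integral_nonneg zero_le_one fun θ _ =>
      mul_nonneg (exp_pos _).le (F.J_nonneg τ θ))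

end T2Flow

/-- For `B₀` solutions, `|⟨e^{ρ−2τ}V_τ⟩| − e^{−2τ}|A| ≲ e^{−τ} e^{2(ΠE)^{1/2}} Π E`. -/
theorem mean_Vtau_bound :
    ∃ C : ℝ, 0 < C ∧ ∀ (F : T2Flow), F.IsEinsteinFlow → (∀ τ : ℝ, F.B τ = 0) →
      ∀ τ : ℝ,
        |circleMean (fun θ => Real.exp (F.ρ τ θ - 2*τ) * F.Vτ τ θ)|
            - Real.exp (-2*τ) * |F.A τ|
          ≤ C * (Real.exp (-τ) * Real.exp (2 * Real.sqrt (F.Pi τ * F.E τ))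
              * (F.Pi τ * F.E τ)) := by
  refine ⟨2, two_pos, fun F _ hB τ => ?_⟩
  have hbound := F.abs_integral_Vτ_sub_A_le τ (hB τ)
  have hnn := F.Pi_mul_E_nonneg τ
  set X := F.Pi τ * F.E τ
  have hsq : √(2 * X) * √(2 * X) = 2 * X := Real.mul_self_sqrt (by positivity)
  have hexp : exp (-3 * τ) * exp τ * exp τ = exp (-τ) := by
    rw [← exp_add, ← exp_add]
    congr 1
    ring
  have hosc : √(2 * X) ≤ 2 * √X := by
    rw [Real.sqrt_le_left (by positivity), mul_pow, Real.sq_sqrt hnn]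
    linarith
  rw [← abs_of_pos (exp_pos (-2 * τ)), ← abs_mul]
  refine (abs_sub_abs_le_abs_sub _ _).trans (hbound.trans ?_)
  calc exp (-3 * τ) * ((exp τ * √(2 * X)) * (exp √(2 * X) * (exp τ * √(2 * X))))
      = (exp (-3 * τ) * exp τ * exp τ) * exp √(2 * X) * (√(2 * X) * √(2 * X)) := by ring
    _ = exp (-τ) * exp √(2 * X) * (2 * X) := by rw [hexp, hsq]
    _ ≤ exp (-τ) * exp (2 * √X) * (2 * X) := by gcongr
    _ = 2 * (exp (-τ) * exp (2 * √X) * X) := by ring
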